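/- arXiv:1405.5342 — 8 statements merged into one kernel-verified Lean document; each statement's English description precedes it below -/
import Mathlib

section
/- Let Δ = ℂ* × {θ ∈ ℂ : 0 ≤ Re(θ) < 2π} and D = {(q₁,q₂) ∈ ℂ² : q₁² + q₂² ≠ 0}, and let φ : Δ → ℂ² be given by φ(r,θ) = (r·cos θ, r·sin θ). Then φ is (complex) differentiable on Δ, its image is exactly D, and for every (q₁,q₂) ∈ D the fiber φ⁻¹(q₁,q₂) contains exactly two points. -/
/-- The complex polar-coordinates map `φ(r,θ) = (r cos θ, r sin θ)`. -/
noncomputable def phi (p : ℂ × ℂ) : ℂ × ℂ :=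
  (p.1 * Complex.cos p.2, p.1 * Complex.sin p.2)

/-- `Δ = ℂ* × {θ ∈ ℂ : 0 ≤ Re θ < 2π}`. -/
def Delta : Set (ℂ × ℂ) :=
  {p | p.1 ≠ 0 ∧ 0 ≤ p.2.re ∧ p.2.re < 2 * Real.pi}

/-- `D = {(q₁,q₂) ∈ ℂ² : q₁² + q₂² ≠ 0}`. -/
def Dset : Set (ℂ × ℂ) := {q | q.1 ^ 2 + q.2 ^ 2 ≠ 0}

theorem angle_exists (c s : ℂ) (h : c ^ 2 + s ^ 2 = 1) :
    ∃ t : ℂ, (0 ≤ t.re ∧ t.re < 2 * Real.pi) ∧ Complex.cos t = c ∧ Complex.sin t = s := by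
  have hI := Complex.I_sq
  have hw : (c + s * Complex.I) * (c - s * Complex.I) = 1 := by
    linear_combination h - s ^ 2 * hI
  have hw0 : c + s * Complex.I ≠ 0 := left_ne_zero_of_mul_eq_one hw
  set w := c + s * Complex.I with hwdef
  have e1 : Complex.exp (-Complex.I * Complex.log w * Complex.I) = w := by
    rw [show -Complex.I * Complex.log w * Complex.I = Complex.log w by
      linear_combination (-Complex.log w) * hI]
    exact Complex.exp_log hw0
  have e2 : Complex.exp (-(-Complex.I * Complex.log w) * Complex.I) = c - s * Complex.I := by
    rw [neg_mul, Complex.exp_neg, e1]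
    exact inv_eq_of_mul_eq_one_right hw
  have hc : Complex.cos (-Complex.I * Complex.log w) = c := by
    rw [Complex.cos, e1, e2, hwdef]; ring
  have hs : Complex.sin (-Complex.I * Complex.log w) = s := by
    rw [Complex.sin, e1, e2, hwdef]; linear_combination (-s) * hI
  have hre : (-Complex.I * Complex.log w).re = w.arg := by
    simp [Complex.log_im]
  have h1 := Complex.neg_pi_lt_arg w
  have h2 := Complex.arg_le_pi w
  have hpi := Real.pi_pos
  by_cases hn : 0 ≤ w.arg
  · exact ⟨_, ⟨by rw [hre]; exact hn, by rw [hre]; linarith⟩, hc, hs⟩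
  · refine ⟨-Complex.I * Complex.log w + 2 * Real.pi, ?_, ?_, ?_⟩
    · have : (-Complex.I * Complex.log w + 2 * Real.pi).re = w.arg + 2 * Real.pi := by
        rw [Complex.add_re, hre]; simp
      rw [this]
      constructor <;> linarith
    · rw [Complex.cos_add_two_pi, hc]
    · rw [Complex.sin_add_two_pi, hs]

theorem angle_unique (t u : ℂ) (ht : 0 ≤ t.re ∧ t.re < 2 * Real.pi)
    (hu : 0 ≤ u.re ∧ u.re < 2 * Real.pi)
    (hc : Complex.cos t = Complex.cos u) (hs : Complex.sin t = Complex.sin u) : t = u := by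
  have h : Complex.exp (t * Complex.I) = Complex.exp (u * Complex.I) := by
    rw [Complex.exp_mul_I, Complex.exp_mul_I, hc, hs]
  obtain ⟨n, hn⟩ := Complex.exp_eq_exp_iff_exists_int.1 h
  have h2 : t = u + n * (2 * Real.pi) := by
    apply mul_right_cancel₀ Complex.I_ne_zero
    rw [hn]; ring
  have h3 : t.re = u.re + n * (2 * Real.pi) := by
    rw [h2]; simp
  have hpi := Real.pi_pos
  have a1 : (n : ℝ) < 1 := by
    by_contra hh
    nlinarith
  have a2 : (-1 : ℝ) < n := by
    by_contra hh
    nlinarith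
  have b1 : n < 1 := by exact_mod_cast a1
  have b2 : -1 < n := by exact_mod_cast a2
  have : n = 0 := by omega
  rw [h2, this]; simp

theorem fiber_exists (q : ℂ × ℂ) (r : ℂ) (hr : r ≠ 0) (h : r ^ 2 = q.1 ^ 2 + q.2 ^ 2) :
    ∃ t : ℂ, (r, t) ∈ Delta ∧ phi (r, t) = q := by
  obtain ⟨t, ht, hc, hs⟩ := angle_exists (q.1 / r) (q.2 / r) (by
    field_simp
    exact h.symm)
  refine ⟨t, ⟨hr, ht⟩, ?_⟩
  apply Prod.ext
  · simp only [phi, hc]; field_simp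
  · simp only [phi, hs]; field_simp

theorem phi_sq (p q : ℂ × ℂ) (h : phi p = q) : p.1 ^ 2 = q.1 ^ 2 + q.2 ^ 2 := by
  subst h
  simp only [phi]
  linear_combination (-p.1 ^ 2) * Complex.sin_sq_add_cos_sq p.2

theorem phi_inj (r t u : ℂ) (ht : (r, t) ∈ Delta) (hu : (r, u) ∈ Delta)
    (h : phi (r, t) = phi (r, u)) : t = u := by
  have hr : r ≠ 0 := ht.1
  simp only [phi, Prod.mk.injEq] at h
  exact angle_unique t u ht.2 hu.2 (mul_left_cancel₀ hr h.1) (mul_left_cancel₀ hr h.2)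

theorem polar_map_properties :
    (∀ p ∈ Delta, DifferentiableAt ℂ phi p) ∧
    phi '' Delta = Dset ∧
    (∀ q ∈ Dset, {p ∈ Delta | phi p = q}.ncard = 2) := by
  have key : ∀ q ∈ Dset, ∃ r : ℂ, r ≠ 0 ∧ r ^ 2 = q.1 ^ 2 + q.2 ^ 2 := by
    intro q hq
    obtain ⟨r, hr⟩ := IsAlgClosed.exists_pow_nat_eq (q.1 ^ 2 + q.2 ^ 2) (n := 2) (by norm_num)
    refine ⟨r, ?_, hr⟩
    rintro rfl
    exact hq (by rw [← hr]; simp)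
  refine ⟨?_, ?_, ?_⟩
  · intro p _
    unfold phi
    fun_prop
  · ext q
    constructor
    · rintro ⟨p, hp, h⟩
      change q.1 ^ 2 + q.2 ^ 2 ≠ 0
      rw [← phi_sq p q h]
      exact pow_ne_zero 2 hp.1
    · intro hq
      obtain ⟨r, hr, h⟩ := key q hq
      obtain ⟨t, ht, he⟩ := fiber_exists q r hr h
      exact ⟨_, ht, he⟩
  · intro q hq
    obtain ⟨r, hr, h⟩ := key q hq
    obtain ⟨t, ht, he⟩ := fiber_exists q r hr h
    obtain ⟨u, hu, hf⟩ := fiber_exists q (-r) (neg_ne_zero.2 hr) (by rw [← h]; ring)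
    rw [Set.ncard_eq_two]
    refine ⟨(r, t), (-r, u), ?_, ?_⟩
    · intro hh
      exact hr (self_eq_neg.1 (Prod.ext_iff.1 hh).1)
    · ext ⟨a, b⟩
      simp only [Set.mem_ofPred_eq, Set.mem_insert_iff, Set.mem_singleton_iff]
      constructor
      · rintro ⟨hp, hq2⟩
        have h2 : a ^ 2 = r ^ 2 := by rw [h]; exact phi_sq _ _ hq2
        rcases sq_eq_sq_iff_eq_or_eq_neg.1 h2 with h3 | h3
        · subst h3
          left; rw [phi_inj _ _ _ hp ht (hq2.trans he.symm)]
        · subst h3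
          right; rw [phi_inj _ _ _ hp hu (hq2.trans hf.symm)]
      · rintro (h3 | h3) <;> rw [h3]
        · exact ⟨ht, he⟩
        · exact ⟨hu, hf⟩
end

section
/- Let V ∈ ℂ(q₁,q₂) be a homogeneous rational function of degree k with polar representation (F,k). Let (q₁,q₂) ∈ ℂ² with q₁²+q₂² ≠ 0, let r ∈ ℂ* satisfy r² = q₁²+q₂², and set z = (q₁+i q₂)/r. Then, at every such point where V is defined, ∂V/∂q₁ = r^{k−2}·(k q₁ F(z) − i q₂ z F′(z)) and ∂V/∂q₂ = r^{k−2}·(k q₂ F(z) + i q₁ z F′(z)). -/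
/-- The value of the rational function `V = P/Q` at the point `(x,y) ∈ ℂ²`. -/
noncomputable def Vfun (P Q : MvPolynomial (Fin 2) ℂ) (x y : ℂ) : ℂ :=
  MvPolynomial.eval ![x, y] P / MvPolynomial.eval ![x, y] Q

/-- The polar representation `F(z) = V((z+z⁻¹)/2, (z−z⁻¹)/(2i))` of `V = P/Q`. -/
noncomputable def Ffun (P Q : MvPolynomial (Fin 2) ℂ) (z : ℂ) : ℂ :=
  Vfun P Q ((z + z⁻¹) / 2) ((z - z⁻¹) / (2 * Complex.I))

/-- The partial derivative `∂V/∂q₁` of `V = P/Q` at `(x,y)`. -/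
noncomputable def pd1 (P Q : MvPolynomial (Fin 2) ℂ) (x y : ℂ) : ℂ :=
  deriv (fun t => Vfun P Q t y) x

/-- The partial derivative `∂V/∂q₂` of `V = P/Q` at `(x,y)`. -/
noncomputable def pd2 (P Q : MvPolynomial (Fin 2) ℂ) (x y : ℂ) : ℂ :=
  deriv (fun t => Vfun P Q x t) y

open MvPolynomial in
theorem aux_hasDerivAt (p : MvPolynomial (Fin 2) ℂ) (a b : ℂ → ℂ) (a' b' t : ℂ)
    (ha : HasDerivAt a a' t) (hb : HasDerivAt b b' t) :
    HasDerivAt (fun t => eval ![a t, b t] p)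
      (eval ![a t, b t] (pderiv 0 p) * a' + eval ![a t, b t] (pderiv 1 p) * b') t := by
  induction p using MvPolynomial.induction_on with
  | C c => simpa using hasDerivAt_const t c
  | add p q hp hq =>
    simp only [map_add]
    exact (hp.add hq).congr_deriv (by ring)
  | mul_X p i hp =>
    fin_cases i
    · have hm := hp.mul ha
      simp
      exact hm.congr_deriv (by ring)
    · have hm := hp.mul hb
      simp
      exact hm.congr_deriv (by ring)

open MvPolynomial in
theorem aux_scale (p : MvPolynomial (Fin 2) ℂ) (n : ℕ) (hp : p.IsHomogeneous n) (r x y : ℂ) :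
    eval ![r * x, r * y] p = r ^ n * eval ![x, y] p := by
  rw [eval_eq', eval_eq', Finset.mul_sum]
  refine Finset.sum_congr rfl fun d hd => ?_
  have h := hp (mem_support_iff.mp hd)
  rw [Finsupp.weight_apply, Finsupp.sum_fintype _ _ (by simp)] at h
  simp at h
  simp [← h, mul_pow, pow_add]
  ring

open MvPolynomial in
theorem aux_scale_pderiv (p : MvPolynomial (Fin 2) ℂ) (n : ℕ) (hp : p.IsHomogeneous n)
    (i : Fin 2) (r x y : ℂ) :
    r * eval ![r * x, r * y] (pderiv i p) = r ^ n * eval ![x, y] (pderiv i p) := by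
  rw [aux_scale _ _ hp.pderiv]
  obtain _ | n := n
  · rw [← totalDegree_zero_iff_isHomogeneous, totalDegree_eq_zero_iff_eq_C] at hp
    rw [hp, pderiv_C]; simp
  · simp [pow_succ]; ring

open MvPolynomial in
theorem aux_euler (p : MvPolynomial (Fin 2) ℂ) (n : ℕ) (hp : p.IsHomogeneous n) (x y : ℂ) :
    x * eval ![x, y] (pderiv 0 p) + y * eval ![x, y] (pderiv 1 p) = n * eval ![x, y] p := by
  have h := congrArg (eval ![x, y]) hp.sum_X_mul_pderiv
  simpa using h

/-- For a homogeneous `V` of degree `k` with polar representation `(F,k)`, at a point with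
`q₁²+q₂² ≠ 0`, `r² = q₁²+q₂²`, `z = (q₁+iq₂)/r`, where `V` is defined:
`∂V/∂q₁ = r^{k−2}(k q₁ F(z) − i q₂ z F′(z))` and `∂V/∂q₂ = r^{k−2}(k q₂ F(z) + i q₁ z F′(z))`. -/
theorem polar_partial_derivatives
    (P Q : MvPolynomial (Fin 2) ℂ) (dP dQ : ℕ) (k : ℤ)
    (hP : P.IsHomogeneous dP) (hQ : Q.IsHomogeneous dQ) (hQ0 : Q ≠ 0)
    (hcop : IsRelPrime P Q) (hk : k = (dP : ℤ) - (dQ : ℤ))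
    (q₁ q₂ r z : ℂ) (hq : q₁ ^ 2 + q₂ ^ 2 ≠ 0) (hr : r ≠ 0)
    (hr2 : r ^ 2 = q₁ ^ 2 + q₂ ^ 2) (hzdef : z = (q₁ + Complex.I * q₂) / r)
    (hdef : MvPolynomial.eval ![q₁, q₂] Q ≠ 0) :
    pd1 P Q q₁ q₂
        = r ^ (k - 2) * ((k : ℂ) * q₁ * Ffun P Q z - Complex.I * q₂ * z * deriv (Ffun P Q) z) ∧
    pd2 P Q q₁ q₂
        = r ^ (k - 2) * ((k : ℂ) * q₂ * Ffun P Q z + Complex.I * q₁ * z * deriv (Ffun P Q) z) := by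
  obtain ⟨c, rfl⟩ : ∃ c, q₁ = r * c := ⟨q₁ / r, by field_simp⟩
  obtain ⟨s, rfl⟩ : ∃ s, q₂ = r * s := ⟨q₂ / r, by field_simp⟩
  have hI := Complex.I_sq
  have hI0 := Complex.I_ne_zero
  have hcs : c ^ 2 + s ^ 2 = 1 := by
    have : r ^ 2 * (c ^ 2 + s ^ 2) = r ^ 2 * 1 := by linear_combination -hr2
    exact mul_left_cancel₀ (pow_ne_zero 2 hr) this
  have hz : z = c + Complex.I * s := by rw [hzdef]; field_simp
  have hzm : z * (c - Complex.I * s) = 1 := by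
    rw [hz]; linear_combination hcs - s ^ 2 * hI
  have hz0 : z ≠ 0 := by rintro h; simp [h] at hzm
  have hzi : z⁻¹ = c - Complex.I * s := inv_eq_of_mul_eq_one_right hzm
  have hc : (z + z⁻¹) / 2 = c := by rw [hzi, hz]; ring
  have hs : (z - z⁻¹) / (2 * Complex.I) = s := by rw [hzi, hz]; field_simp; ring
  have hA : HasDerivAt (fun z : ℂ => (z + z⁻¹) / 2) (Complex.I * s / z) z := by
    refine (((hasDerivAt_id z).add (hasDerivAt_inv hz0)).div_const 2).congr_deriv ?_
    have : Complex.I * s = (z - z⁻¹) / 2 := by rw [hzi, hz]; ring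
    rw [this]; field_simp; ring
  have hB : HasDerivAt (fun z : ℂ => (z - z⁻¹) / (2 * Complex.I)) (-Complex.I * c / z) z := by
    refine (((hasDerivAt_id z).sub (hasDerivAt_inv hz0)).div_const (2 * Complex.I)).congr_deriv ?_
    have : c = (z + z⁻¹) / 2 := hc.symm
    rw [this]; field_simp; rw [hI]; ring
  have eP := aux_euler P dP hP c s
  have eQ := aux_euler Q dQ hQ c s
  have sP := aux_scale P dP hP r c s
  have sQ := aux_scale Q dQ hQ r c s
  have sP0 := aux_scale_pderiv P dP hP 0 r c s
  have sQ0 := aux_scale_pderiv Q dQ hQ 0 r c s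
  have sP1 := aux_scale_pderiv P dP hP 1 r c s
  have sQ1 := aux_scale_pderiv Q dQ hQ 1 r c s
  have hu : MvPolynomial.eval ![c, s] Q ≠ 0 := by
    intro h; rw [sQ, h] at hdef; simp at hdef
  have dF := (aux_hasDerivAt P _ _ _ _ z hA hB).div (aux_hasDerivAt Q _ _ _ _ z hA hB)
    (by rw [hc, hs]; exact hu)
  have d1 := (aux_hasDerivAt P (fun t => t) (fun _ => r * s) _ _ (r * c)
    (hasDerivAt_id' _) (hasDerivAt_const _ _)).div (aux_hasDerivAt Q (fun t => t) (fun _ => r * s)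
    _ _ (r * c) (hasDerivAt_id' _) (hasDerivAt_const _ _)) hdef
  have d2 := (aux_hasDerivAt P (fun _ => r * c) (fun t => t) _ _ (r * s)
    (hasDerivAt_const _ _) (hasDerivAt_id' _)).div (aux_hasDerivAt Q (fun _ => r * c) (fun t => t)
    _ _ (r * s) (hasDerivAt_const _ _) (hasDerivAt_id' _)) hdef
  have e1 : pd1 P Q (r * c) (r * s) = _ := d1.deriv
  have e2 : pd2 P Q (r * c) (r * s) = _ := d2.deriv
  have eF : deriv (Ffun P Q) z = _ := dF.deriv
  have eF0 : Ffun P Q z = MvPolynomial.eval ![c, s] P / MvPolynomial.eval ![c, s] Q := by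
    unfold Ffun Vfun; rw [hc, hs]
  rw [e1, e2, eF, eF0]
  have hrk : r ^ (k - 2) = r ^ dP / (r ^ dQ * r ^ 2) := by
    rw [hk, zpow_sub₀ hr, zpow_sub₀ hr]; simp; norm_cast; field_simp
  have hkc : (k : ℂ) = dP - dQ := by rw [hk]; push_cast; rfl
  rw [hrk, hkc]
  simp only [hc, hs, mul_one, mul_zero, add_zero, zero_add]
  rw [mul_comm, ← eq_div_iff hr] at sP0 sQ0 sP1 sQ1
  rw [sP, sQ, sP0, sQ0, sP1, sQ1]
  have hrP : r ^ dP ≠ 0 := pow_ne_zero _ hr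
  have hrQ : r ^ dQ ≠ 0 := pow_ne_zero _ hr
  generalize r ^ dP = A at *
  generalize r ^ dQ = B at *
  clear dF d1 d2 e1 e2 eF eF0 sP sQ sP0 sQ0 sP1 sQ1 hdef
  generalize MvPolynomial.eval ![c, s] (MvPolynomial.pderiv 0 P) = p1 at *
  generalize MvPolynomial.eval ![c, s] (MvPolynomial.pderiv 1 P) = p2 at *
  generalize MvPolynomial.eval ![c, s] (MvPolynomial.pderiv 0 Q) = w1 at *
  generalize MvPolynomial.eval ![c, s] (MvPolynomial.pderiv 1 Q) = w2 at *
  generalize MvPolynomial.eval ![c, s] P = p at *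
  generalize MvPolynomial.eval ![c, s] Q = w at *
  clear hzi hzm hc hs hA hB hzdef hr2 hq hz
  constructor
  · field_simp
    rw [hI]
    linear_combination c * w * eP - c * p * eQ - (p1 * w - p * w1) * hcs
  · field_simp
    rw [hI]
    linear_combination s * w * eP - s * p * eQ - (p2 * w - p * w2) * hcs
end

section
/- Let V ∈ ℂ(q₁,q₂) be a homogeneous rational function of degree k with polar representation (F,k). Let (q₁,q₂) ∈ ℂ² with q₁²+q₂² ≠ 0, let r ∈ ℂ* satisfy r² = q₁²+q₂², and set z = (q₁+i q₂)/r. Then, at every such point where V is defined, q₁·∂V/∂q₂ − q₂·∂V/∂q₁ = i · r^k · z · F′(z). -/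
/-- Chain rule for a bivariate polynomial along a curve. -/
theorem hasDerivAt_eval_curve (P : MvPolynomial (Fin 2) ℂ) (x y : ℂ → ℂ) (x' y' t : ℂ)
    (hx : HasDerivAt x x' t) (hy : HasDerivAt y y' t) :
    HasDerivAt (fun s => MvPolynomial.eval ![x s, y s] P)
      (MvPolynomial.eval ![x t, y t] (MvPolynomial.pderiv 0 P) * x'
        + MvPolynomial.eval ![x t, y t] (MvPolynomial.pderiv 1 P) * y') t := by
  induction P using MvPolynomial.induction_on with
  | C a => simpa using hasDerivAt_const t a
  | add p q hp hq =>
    simp only [map_add]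
    refine (hp.add hq).congr_deriv ?_
    ring
  | mul_X p i hp =>
    simp only [map_mul, MvPolynomial.eval_X]
    fin_cases i
    · simp only [Fin.zero_eta, Matrix.cons_val_zero]
      refine (hp.mul hx).congr_deriv ?_
      simp [Derivation.leibniz, MvPolynomial.pderiv_X]
      ring
    · simp only [Fin.mk_one, Matrix.cons_val_one]
      refine (hp.mul hy).congr_deriv ?_
      simp [Derivation.leibniz, MvPolynomial.pderiv_X]
      ring

theorem eval_scale (P : MvPolynomial (Fin 2) ℂ) (d : ℕ) (hP : P.IsHomogeneous d) (r x y : ℂ) :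
    MvPolynomial.eval ![r * x, r * y] P = r ^ d * MvPolynomial.eval ![x, y] P := by
  rw [MvPolynomial.eval_eq', MvPolynomial.eval_eq', Finset.mul_sum]
  refine Finset.sum_congr rfl fun m hm => ?_
  have h := hP (MvPolynomial.mem_support_iff.mp hm)
  rw [← h, Finsupp.weight_apply, Finsupp.sum_fintype _ _ (by simp)]
  simp [Fin.prod_univ_two, Fin.sum_univ_two, mul_pow, pow_add]
  ring

/-- Chain rule for the quotient along a curve. -/
theorem hasDerivAt_Vfun_curve (P Q : MvPolynomial (Fin 2) ℂ) (a b : ℂ)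
    (h : MvPolynomial.eval ![a, b] Q ≠ 0) :
    ∃ A B : ℂ, ∀ (x y : ℂ → ℂ) (x' y' t : ℂ), x t = a → y t = b →
      HasDerivAt x x' t → HasDerivAt y y' t →
      HasDerivAt (fun s => Vfun P Q (x s) (y s)) (A * x' + B * y') t := by
  let e := fun p : MvPolynomial (Fin 2) ℂ => MvPolynomial.eval ![a, b] p
  refine ⟨(e (MvPolynomial.pderiv 0 P) * e Q - e P * e (MvPolynomial.pderiv 0 Q)) / e Q ^ 2,
    (e (MvPolynomial.pderiv 1 P) * e Q - e P * e (MvPolynomial.pderiv 1 Q)) / e Q ^ 2, ?_⟩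
  intro x y x' y' t hxa hyb hx hy
  have h1 := hasDerivAt_eval_curve P x y x' y' t hx hy
  have h2 := hasDerivAt_eval_curve Q x y x' y' t hx hy
  have h3 := h1.div h2 (by rw [hxa, hyb]; exact h)
  unfold Vfun
  refine h3.congr_deriv ?_
  rw [hxa, hyb]
  simp only [e]
  ring

/-- For a homogeneous `V` of degree `k` with polar representation `(F,k)`, at a point with
`q₁²+q₂² ≠ 0`, `r² = q₁²+q₂²`, `z = (q₁+iq₂)/r`, where `V` is defined:
`q₁·∂V/∂q₂ − q₂·∂V/∂q₁ = i r^k z F′(z)`. -/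
theorem polar_euler_type_relation
    (P Q : MvPolynomial (Fin 2) ℂ) (dP dQ : ℕ) (k : ℤ)
    (hP : P.IsHomogeneous dP) (hQ : Q.IsHomogeneous dQ) (hQ0 : Q ≠ 0)
    (hcop : IsRelPrime P Q) (hk : k = (dP : ℤ) - (dQ : ℤ))
    (q₁ q₂ r z : ℂ) (hq : q₁ ^ 2 + q₂ ^ 2 ≠ 0) (hr : r ≠ 0)
    (hr2 : r ^ 2 = q₁ ^ 2 + q₂ ^ 2) (hzdef : z = (q₁ + Complex.I * q₂) / r)
    (hdef : MvPolynomial.eval ![q₁, q₂] Q ≠ 0) :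
    q₁ * pd2 P Q q₁ q₂ - q₂ * pd1 P Q q₁ q₂
      = Complex.I * r ^ k * z * deriv (Ffun P Q) z := by
  obtain ⟨A, B, hAB⟩ := hasDerivAt_Vfun_curve P Q q₁ q₂ hdef
  have e1 : pd1 P Q q₁ q₂ = A := by
    have := hAB (fun t => t) (fun _ => q₂) 1 0 q₁ rfl rfl (hasDerivAt_id _) (hasDerivAt_const _ _)
    simpa [pd1] using this.deriv
  have e2 : pd2 P Q q₁ q₂ = B := by
    have := hAB (fun _ => q₁) (fun t => t) 0 1 q₂ rfl rfl (hasDerivAt_const _ _) (hasDerivAt_id _)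
    simpa [pd2] using this.deriv
  have hI : Complex.I ^ 2 = -1 := Complex.I_sq
  have hI0 : Complex.I ≠ 0 := Complex.I_ne_zero
  have hprod : z * ((q₁ - Complex.I * q₂) / r) = 1 := by
    rw [hzdef]
    field_simp
    linear_combination (-1 : ℂ) * hr2 - q₂ ^ 2 * hI
  have hz0 : z ≠ 0 := left_ne_zero_of_mul_eq_one hprod
  have hinv : z⁻¹ = (q₁ - Complex.I * q₂) / r := inv_eq_of_mul_eq_one_right hprod
  have hrz : r * z = q₁ + Complex.I * q₂ := by rw [hzdef]; field_simp
  have hrzi : r * z⁻¹ = q₁ - Complex.I * q₂ := by rw [hinv]; field_simp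
  have hF : ∀ w, Ffun P Q w
      = (r ^ k)⁻¹ * Vfun P Q (r * ((w + w⁻¹) / 2)) (r * ((w - w⁻¹) / (2 * Complex.I))) := by
    intro w
    unfold Ffun Vfun
    rw [eval_scale P dP hP, eval_scale Q dQ hQ, hk, zpow_sub₀ hr, zpow_natCast, zpow_natCast]
    have h1 : r ^ dP ≠ 0 := pow_ne_zero _ hr
    have h2 : r ^ dQ ≠ 0 := pow_ne_zero _ hr
    rw [mul_div_mul_comm, ← mul_assoc, inv_mul_cancel₀ (div_ne_zero h1 h2), one_mul]
  have hiw := hasDerivAt_inv hz0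
  have hx := (((hasDerivAt_id z).add hiw).div_const 2).const_mul r
  have hy := (((hasDerivAt_id z).sub hiw).div_const (2 * Complex.I)).const_mul r
  have hD := (hAB _ _ _ _ z (by
      simp only [Pi.add_apply, id]
      linear_combination (1 / 2 : ℂ) * hrz + (1 / 2 : ℂ) * hrzi) (by
      simp only [Pi.sub_apply, id]
      rw [← mul_div_assoc, mul_sub, hrz, hrzi, div_eq_iff (mul_ne_zero two_ne_zero hI0)]
      ring) hx hy).const_mul ((r ^ k)⁻¹)
  have hd := (hD.congr_of_eventuallyEq (Filter.Eventually.of_forall hF)).deriv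
  rw [hd, e1, e2]
  have hrk : r ^ k ≠ 0 := zpow_ne_zero _ hr
  have hx2 : z * (r * ((1 + -(z ^ 2)⁻¹) / 2)) = Complex.I * q₂ := by
    have : z * (r * ((1 + -(z ^ 2)⁻¹) / 2)) = (r * z - r * z⁻¹) / 2 := by field_simp; ring
    rw [this, hrz, hrzi]; ring
  have hy2 : z * (r * ((1 - -(z ^ 2)⁻¹) / (2 * Complex.I))) = - Complex.I * q₁ := by
    have : z * (r * ((1 - -(z ^ 2)⁻¹) / (2 * Complex.I))) = (r * z + r * z⁻¹) / (2 * Complex.I) := by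
      field_simp
      ring
    rw [this, hrz, hrzi]
    field_simp
    linear_combination (2 * q₁) * hI
  generalize r * ((1 + -(z ^ 2)⁻¹) / 2) = X at *
  generalize r * ((1 - -(z ^ 2)⁻¹) / (2 * Complex.I)) = Y at *
  have : Complex.I * r ^ k * z * ((r ^ k)⁻¹ * (A * X + B * Y))
      = Complex.I * (A * (z * X) + B * (z * Y)) := by
    field_simp
  rw [this, hx2, hy2]
  linear_combination (B * q₁ - A * q₂) * hI
end

section
/- Let V ∈ ℂ(q₁,q₂) be a homogeneous rational function of degree k ≠ 0 with polar representation (F,k), and let c = (c₁,c₂) with c₁²+c₂² ≠ 0 be a Darboux point of V, i.e. ∂V/∂q₁(c) = k c₁ and ∂V/∂q₂(c) = k c₂. Then for any (r,θ) ∈ ℂ* × ℂ with (r cos θ, r sin θ) = (c₁,c₂), one has F′(e^{iθ}) = 0 and F(e^{iθ}) = r^{2−k}. -/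
theorem eval_smul_aux (P : MvPolynomial (Fin 2) ℂ) (d : ℕ) (hP : P.IsHomogeneous d) (s x y : ℂ) :
    MvPolynomial.eval ![s * x, s * y] P = s ^ d * MvPolynomial.eval ![x, y] P := by
  have h : (![s * x, s * y] : Fin 2 → ℂ) = fun i => s * ![x, y] i := by
    funext i
    fin_cases i <;> simp
  rw [h, MvPolynomial.eval_eq', MvPolynomial.eval_eq', Finset.mul_sum]
  refine Finset.sum_congr rfl fun m hm => ?_
  have hd := hP (MvPolynomial.mem_support_iff.mp hm)
  rw [Finsupp.weight_apply, Finsupp.sum_fintype _ _ (by simp)] at hd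
  simp only [Fin.sum_univ_two, Pi.one_apply, smul_eq_mul, mul_one] at hd
  simp only [Fin.prod_univ_two, mul_pow, ← hd, pow_add]
  ring

theorem Vfun_smul_aux (P Q : MvPolynomial (Fin 2) ℂ) (dP dQ : ℕ)
    (hP : P.IsHomogeneous dP) (hQ : Q.IsHomogeneous dQ) (s x y : ℂ) (hs : s ≠ 0) :
    Vfun P Q (s * x) (s * y) = s ^ ((dP : ℤ) - (dQ : ℤ)) * Vfun P Q x y := by
  unfold Vfun
  rw [eval_smul_aux P dP hP, eval_smul_aux Q dQ hQ, zpow_sub₀ hs, zpow_natCast, zpow_natCast,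
    mul_div_mul_comm]

theorem diff_eval_aux (P : MvPolynomial (Fin 2) ℂ) :
    Differentiable ℂ (fun p : ℂ × ℂ => MvPolynomial.eval ![p.1, p.2] P) := by
  induction P using MvPolynomial.induction_on with
  | C a => simp
  | add p q hp hq => simp only [map_add]; exact hp.add hq
  | mul_X p i hp =>
    simp only [map_mul, MvPolynomial.eval_X]
    refine hp.mul ?_
    fin_cases i
    · simp
    · simp

/-- If `c = (c₁,c₂)` with `c₁²+c₂² ≠ 0` is a Darboux point of a homogeneous `V` of degree
`k ≠ 0` (i.e. `∂V/∂q₁(c) = k c₁`, `∂V/∂q₂(c) = k c₂`), then for any `(r,θ) ∈ ℂ* × ℂ` with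
`(r cos θ, r sin θ) = (c₁,c₂)` one has `F′(e^{iθ}) = 0` and `F(e^{iθ}) = r^{2−k}`. -/
theorem darboux_point_polar
    (P Q : MvPolynomial (Fin 2) ℂ) (dP dQ : ℕ) (k : ℤ)
    (hP : P.IsHomogeneous dP) (hQ : Q.IsHomogeneous dQ) (hQ0 : Q ≠ 0)
    (hcop : IsRelPrime P Q) (hk : k = (dP : ℤ) - (dQ : ℤ)) (hk0 : k ≠ 0)
    (c₁ c₂ : ℂ) (hc : c₁ ^ 2 + c₂ ^ 2 ≠ 0)
    (hdef : MvPolynomial.eval ![c₁, c₂] Q ≠ 0)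
    (hd1 : pd1 P Q c₁ c₂ = (k : ℂ) * c₁) (hd2 : pd2 P Q c₁ c₂ = (k : ℂ) * c₂)
    (r θ : ℂ) (hr : r ≠ 0)
    (hrθ : r * Complex.cos θ = c₁ ∧ r * Complex.sin θ = c₂) :
    deriv (Ffun P Q) (Complex.exp (Complex.I * θ)) = 0 ∧
    Ffun P Q (Complex.exp (Complex.I * θ)) = r ^ ((2 : ℤ) - k) := by
  obtain ⟨h1, h2⟩ := hrθ
  have hV : DifferentiableAt ℂ (fun p : ℂ × ℂ => Vfun P Q p.1 p.2) (c₁, c₂) := by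
    have hp := diff_eval_aux P (c₁, c₂)
    have hq := diff_eval_aux Q (c₁, c₂)
    simp only [Vfun, div_eq_mul_inv]
    exact hp.fun_mul (hq.fun_inv hdef)
  obtain ⟨L, hL⟩ := hV
  have hL1 : L (1, 0) = k * c₁ := by
    rw [← hd1]
    have hg : HasDerivAt (fun t : ℂ => (t, c₂)) (1, 0) c₁ :=
      (hasDerivAt_id c₁).prodMk (hasDerivAt_const c₁ c₂)
    exact (HasFDerivAt.comp_hasDerivAt c₁ hL hg).deriv.symm
  have hL2 : L (0, 1) = k * c₂ := by
    rw [← hd2]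
    have hg : HasDerivAt (fun t : ℂ => (c₁, t)) (0, 1) c₂ :=
      (hasDerivAt_const c₂ c₁).prodMk (hasDerivAt_id c₂)
    exact (HasFDerivAt.comp_hasDerivAt c₂ hL hg).deriv.symm
  have hLab : ∀ a b : ℂ, L (a, b) = k * (c₁ * a + c₂ * b) := by
    intro a b
    have : ((a, b) : ℂ × ℂ) = a • ((1, 0) : ℂ × ℂ) + b • ((0, 1) : ℂ × ℂ) := by simp
    rw [this, map_add, map_smul, map_smul, hL1, hL2, smul_eq_mul, smul_eq_mul]
    ring
  have hkC : (k : ℂ) ≠ 0 := by exact_mod_cast hk0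
  have hEuler : c₁ ^ 2 + c₂ ^ 2 = Vfun P Q c₁ c₂ := by
    have hg : HasDerivAt (fun s : ℂ => (s * c₁, s * c₂)) (1 * c₁, 1 * c₂) 1 :=
      ((hasDerivAt_id (1 : ℂ)).mul_const c₁).prodMk ((hasDerivAt_id (1 : ℂ)).mul_const c₂)
    have hL' : HasFDerivAt (fun p : ℂ × ℂ => Vfun P Q p.1 p.2) L (1 * c₁, 1 * c₂) := by
      simpa using hL
    have hA := HasFDerivAt.comp_hasDerivAt (1 : ℂ) hL' hg
    have hB : HasDerivAt (fun s : ℂ => s ^ k * Vfun P Q c₁ c₂)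
        ((k * (1 : ℂ) ^ (k - 1)) * Vfun P Q c₁ c₂) 1 :=
      (hasDerivAt_zpow k 1 (Or.inl one_ne_zero)).mul_const _
    have hev : (fun s : ℂ => s ^ k * Vfun P Q c₁ c₂) =ᶠ[nhds 1]
        ((fun p : ℂ × ℂ => Vfun P Q p.1 p.2) ∘ fun s : ℂ => (s * c₁, s * c₂)) := by
      filter_upwards [isOpen_ne.mem_nhds (one_ne_zero : (1 : ℂ) ≠ 0)] with s hs
      simp only [Function.comp]
      rw [Vfun_smul_aux P Q dP dQ hP hQ s c₁ c₂ hs, hk]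
    have hu := (hA.congr_of_eventuallyEq hev).unique hB
    rw [hLab, one_zpow] at hu
    apply mul_left_cancel₀ hkC
    linear_combination hu
  have hz0 : Complex.exp (Complex.I * θ) ≠ 0 := Complex.exp_ne_zero _
  have hinv : (Complex.exp (Complex.I * θ))⁻¹ = Complex.exp (-θ * Complex.I) := by
    rw [← Complex.exp_neg]; ring_nf
  have hcos : (Complex.exp (Complex.I * θ) + (Complex.exp (Complex.I * θ))⁻¹) / 2
      = Complex.cos θ := by
    rw [hinv, Complex.cos, mul_comm Complex.I θ]
  have hsin : (Complex.exp (Complex.I * θ) - (Complex.exp (Complex.I * θ))⁻¹) / (2 * Complex.I)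
      = Complex.sin θ := by
    rw [hinv, Complex.sin, mul_comm Complex.I θ, div_mul_eq_div_div, Complex.div_I]
    ring
  have hrk : r ^ k ≠ 0 := zpow_ne_zero _ hr
  have hscale : ∀ x y : ℂ, Vfun P Q x y = (r ^ k)⁻¹ * Vfun P Q (r * x) (r * y) := by
    intro x y
    rw [Vfun_smul_aux P Q dP dQ hP hQ r x y hr, ← hk, inv_mul_cancel_left₀ hrk]
  generalize Complex.exp (Complex.I * θ) = z at *
  constructor
  · have hF : Ffun P Q = fun w => (r ^ k)⁻¹ * ((fun p : ℂ × ℂ => Vfun P Q p.1 p.2) ∘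
        fun w : ℂ => (r * ((w + w⁻¹) / 2), r * ((w - w⁻¹) / (2 * Complex.I)))) w := by
      funext w
      exact hscale _ _
    have hi := hasDerivAt_inv hz0
    have hg : HasDerivAt
        (fun w : ℂ => (r * ((w + w⁻¹) / 2), r * ((w - w⁻¹) / (2 * Complex.I))))
        (r * ((1 + -(z ^ 2)⁻¹) / 2), r * ((1 - -(z ^ 2)⁻¹) / (2 * Complex.I))) z :=
      ((((hasDerivAt_id z).add hi).div_const 2).const_mul r).prodMk
        ((((hasDerivAt_id z).sub hi).div_const (2 * Complex.I)).const_mul r)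
    have hL' : HasFDerivAt (fun p : ℂ × ℂ => Vfun P Q p.1 p.2) L
        (r * ((z + z⁻¹) / 2), r * ((z - z⁻¹) / (2 * Complex.I))) := by
      rw [hcos, hsin, h1, h2]; exact hL
    have hA := (HasFDerivAt.comp_hasDerivAt z hL' hg).const_mul (r ^ k)⁻¹
    rw [hF, hA.deriv, hLab, ← h1, ← h2, ← hcos, ← hsin]
    have hI := Complex.I_ne_zero
    have hI2 := Complex.I_sq
    field_simp
    rw [hI2]
    ring
  · have : Ffun P Q z = (r ^ k)⁻¹ * r ^ 2 := by
      unfold Ffun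
      rw [hscale, hcos, hsin, h1, h2, ← hEuler, ← h1, ← h2]
      linear_combination (r ^ k)⁻¹ * r ^ 2 * Complex.cos_sq_add_sin_sq θ
    rw [this, zpow_sub₀ hr, div_eq_inv_mul]
    norm_cast
end

section
/- Let k be an integer with k ∉ {−2, 0, 2}. Every element λ of the Morales–Ramis set E_k satisfies λ ≥ min(0, k). In particular, for every j ∈ ℤ one has (1/2)·jk·(jk+k−2) ≥ min(0,k) and (1/2)·(jk+1)·(jk+k−1) ≥ min(0,k). -/
/-- The first Morales–Ramis family `A_k = {(1/2)jk(jk+k−2) : j ∈ ℤ}`. -/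
def MRfamA (k : ℤ) : Set ℚ :=
  {x | ∃ j : ℤ, x = (1/2 : ℚ) * ((j : ℚ) * k) * ((j : ℚ) * k + k - 2)}

/-- The second Morales–Ramis family `B_k = {(1/2)(jk+1)(jk+k−1) : j ∈ ℤ}`. -/
def MRfamB (k : ℤ) : Set ℚ :=
  {x | ∃ j : ℤ, x = (1/2 : ℚ) * ((j : ℚ) * k + 1) * ((j : ℚ) * k + k - 1)}

/-- The additional Morales–Ramis families `C_k`, nonempty only for `k ∈ {±3,±4,±5}`. -/
def MRextra (k : ℤ) : Set ℚ :=
  if k = -5 then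
    {x | ∃ j : ℤ, x = -49/8 + (1/8 : ℚ) * (10/3 + 10 * (j : ℚ)) ^ 2 ∨
                  x = -49/8 + (1/8 : ℚ) * (4 + 10 * (j : ℚ)) ^ 2}
  else if k = -4 then
    {x | ∃ j : ℤ, x = -9/2 + (1/2 : ℚ) * (4/3 + 4 * (j : ℚ)) ^ 2}
  else if k = -3 then
    {x | ∃ j : ℤ, x = -25/8 + (1/8 : ℚ) * (2 + 6 * (j : ℚ)) ^ 2 ∨
                  x = -25/8 + (1/8 : ℚ) * (3/2 + 6 * (j : ℚ)) ^ 2 ∨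
                  x = -25/8 + (1/8 : ℚ) * (6/5 + 6 * (j : ℚ)) ^ 2 ∨
                  x = -25/8 + (1/8 : ℚ) * (12/5 + 6 * (j : ℚ)) ^ 2}
  else if k = 3 then
    {x | ∃ j : ℤ, x = -1/8 + (1/8 : ℚ) * (2 + 6 * (j : ℚ)) ^ 2 ∨
                  x = -1/8 + (1/8 : ℚ) * (3/2 + 6 * (j : ℚ)) ^ 2 ∨
                  x = -1/8 + (1/8 : ℚ) * (6/5 + 6 * (j : ℚ)) ^ 2 ∨
                  x = -1/8 + (1/8 : ℚ) * (12/5 + 6 * (j : ℚ)) ^ 2}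
  else if k = 4 then
    {x | ∃ j : ℤ, x = -1/2 + (1/2 : ℚ) * (4/3 + 4 * (j : ℚ)) ^ 2}
  else if k = 5 then
    {x | ∃ j : ℤ, x = -9/8 + (1/8 : ℚ) * (10/3 + 10 * (j : ℚ)) ^ 2 ∨
                  x = -9/8 + (1/8 : ℚ) * (4 + 10 * (j : ℚ)) ^ 2}
  else ∅

/-- The Morales–Ramis set `E_k ⊆ ℚ`. -/
def MRset (k : ℤ) : Set ℚ := MRfamA k ∪ MRfamB k ∪ MRextra k

theorem mr_consec (j : ℤ) : 0 ≤ j * (j + 1) := by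
  rcases le_or_gt 0 j with h | h
  · positivity
  · nlinarith

theorem mr_A_int (k : ℤ) (hk : k ≠ -2 ∧ k ≠ 0 ∧ k ≠ 2) (j : ℤ) :
    2 * min 0 k ≤ j * k * (j * k + k - 2) := by
  obtain ⟨h1, h2, h3⟩ := hk
  rcases lt_or_gt_of_ne h2 with hneg | hpos
  · rw [min_eq_right hneg.le]
    have key : 0 ≤ (-k) * ((j + 1) * (2 - k * j)) := by
      apply mul_nonneg (by omega)
      rcases le_or_gt (-1) j with hj | hj
      · rcases eq_or_lt_of_le hj with hj' | hj'
        · subst hj'; simp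
        · have : k * j ≤ 0 := mul_nonpos_of_nonpos_of_nonneg hneg.le (by omega)
          exact mul_nonneg (by omega) (by omega)
      · have : 2 ≤ k * j := by nlinarith
        exact mul_nonneg_of_nonpos_of_nonpos (by omega) (by omega)
    nlinarith
  · rw [min_eq_left hpos.le]
    by_cases hk1 : k = 1
    · subst hk1
      have := mr_consec (j - 1)
      nlinarith
    · have hk3 : 3 ≤ k := by omega
      rcases le_or_gt 0 j with hj | hj
      · have : 0 ≤ j * k := by positivity
        exact mul_nonneg this (by omega)
      · have : j * k ≤ -k := by nlinarith
        exact mul_nonneg_of_nonpos_of_nonpos (by omega) (by omega)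

theorem mr_B_int (k : ℤ) (hk : k ≠ -2 ∧ k ≠ 0 ∧ k ≠ 2) (j : ℤ) :
    2 * min 0 k ≤ (j * k + 1) * (j * k + k - 1) := by
  have h := mul_nonneg (sq_nonneg k) (mr_consec j)
  rcases lt_or_gt_of_ne hk.2.1 with hneg | hpos
  · rw [min_eq_right hneg.le]
    nlinarith
  · rw [min_eq_left hpos.le]
    nlinarith

theorem mr_AB (k : ℤ) (hk : k ≠ -2 ∧ k ≠ 0 ∧ k ≠ 2) (j : ℤ) :
    min (0 : ℚ) (k : ℚ) ≤ (1/2 : ℚ) * ((j : ℚ) * k) * ((j : ℚ) * k + k - 2) ∧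
    min (0 : ℚ) (k : ℚ) ≤ (1/2 : ℚ) * ((j : ℚ) * k + 1) * ((j : ℚ) * k + k - 1) := by
  have hA : ((2 * min 0 k : ℤ) : ℚ) ≤ ((j * k * (j * k + k - 2) : ℤ) : ℚ) :=
    Int.cast_le.mpr (mr_A_int k hk j)
  have hB : ((2 * min 0 k : ℤ) : ℚ) ≤ (((j * k + 1) * (j * k + k - 1) : ℤ) : ℚ) :=
    Int.cast_le.mpr (mr_B_int k hk j)
  push_cast at hA hB
  constructor <;> linarith

theorem mr_sq (a b : ℚ) (ha : 0 ≤ a) (hab : 2 * a ≤ b) (j : ℤ) :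
    a ^ 2 ≤ (a + b * (j : ℚ)) ^ 2 := by
  have h : (0 : ℚ) ≤ (j : ℚ) * (j + 1) := by exact_mod_cast mr_consec j
  have h2 : (0 : ℚ) ≤ (j : ℚ) ^ 2 - j := by
    have : (0 : ℤ) ≤ (j - 1) * (j - 1 + 1) := mr_consec (j - 1)
    have h3 : (0 : ℚ) ≤ ((j : ℚ) - 1) * (j - 1 + 1) := by exact_mod_cast this
    linarith
  have hb : 0 ≤ b := by linarith
  nlinarith [mul_nonneg (mul_nonneg hb (sub_nonneg.mpr hab)) (sq_nonneg (j : ℚ)),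
    mul_nonneg (mul_nonneg hb ha) h, mul_nonneg (mul_nonneg hb ha) h2]

theorem mr_extra (k : ℤ) (x : ℚ) (hx : x ∈ MRextra k) : min (0 : ℚ) (k : ℚ) ≤ x := by
  unfold MRextra at hx
  split_ifs at hx with h1 h2 h3 h4 h5 h6
  · subst h1
    obtain ⟨j, h | h⟩ := hx <;> apply min_le_of_right_le <;> push_cast
    · linarith [mr_sq (10/3) 10 (by norm_num) (by norm_num) j]
    · linarith [mr_sq 4 10 (by norm_num) (by norm_num) j]
  · subst h2
    obtain ⟨j, h⟩ := hx
    apply min_le_of_right_le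
    push_cast
    linarith [mr_sq (4/3) 4 (by norm_num) (by norm_num) j]
  · subst h3
    obtain ⟨j, h | h | h | h⟩ := hx <;> apply min_le_of_right_le <;> push_cast
    · linarith [mr_sq 2 6 (by norm_num) (by norm_num) j]
    · linarith [mr_sq (3/2) 6 (by norm_num) (by norm_num) j]
    · linarith [mr_sq (6/5) 6 (by norm_num) (by norm_num) j]
    · linarith [mr_sq (12/5) 6 (by norm_num) (by norm_num) j]
  · obtain ⟨j, h | h | h | h⟩ := hx <;> apply min_le_of_left_le
    · linarith [mr_sq 2 6 (by norm_num) (by norm_num) j]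
    · linarith [mr_sq (3/2) 6 (by norm_num) (by norm_num) j]
    · linarith [mr_sq (6/5) 6 (by norm_num) (by norm_num) j]
    · linarith [mr_sq (12/5) 6 (by norm_num) (by norm_num) j]
  · obtain ⟨j, h⟩ := hx
    apply min_le_of_left_le
    linarith [mr_sq (4/3) 4 (by norm_num) (by norm_num) j]
  · obtain ⟨j, h | h⟩ := hx <;> apply min_le_of_left_le
    · linarith [mr_sq (10/3) 10 (by norm_num) (by norm_num) j]
    · linarith [mr_sq 4 10 (by norm_num) (by norm_num) j]
  · exact absurd hx (Set.notMem_empty x)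

/-- For an integer `k ∉ {−2,0,2}`, every element of the Morales–Ramis set `E_k` is at least
`min(0,k)`. In particular `(1/2)jk(jk+k−2) ≥ min(0,k)` and `(1/2)(jk+1)(jk+k−1) ≥ min(0,k)`
for every `j ∈ ℤ`. -/
theorem morales_ramis_lower_bound
    (k : ℤ) (hk : k ≠ -2 ∧ k ≠ 0 ∧ k ≠ 2) :
    (∀ lam ∈ MRset k, min (0 : ℚ) (k : ℚ) ≤ lam) ∧
    (∀ j : ℤ,
      min (0 : ℚ) (k : ℚ) ≤ (1/2 : ℚ) * ((j : ℚ) * k) * ((j : ℚ) * k + k - 2) ∧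
      min (0 : ℚ) (k : ℚ) ≤ (1/2 : ℚ) * ((j : ℚ) * k + 1) * ((j : ℚ) * k + k - 1)) := by
  refine ⟨?_, mr_AB k hk⟩
  rintro x ((⟨j, rfl⟩ | ⟨j, rfl⟩) | hx)
  · exact (mr_AB k hk j).1
  · exact (mr_AB k hk j).2
  · exact mr_extra k x hx
end

section
/- Let k be an integer with k ∉ {−2, 0, 2}, let p ≥ 1 be an integer and c ∈ ℚ. Then the set of nondecreasing tuples (λ₁ ≤ λ₂ ≤ … ≤ λ_p) of rational numbers such that each λ_i belongs to the Morales–Ramis set E_k, each λ_i ≠ k, and ∑_{i=1}^p 1/(λ_i − k) = c, is finite. -/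
theorem mr_quad_finite (u a b d M : ℚ) (ha : 0 < a) (hd : d ≠ 0) :
    {x : ℚ | (∃ j : ℤ, x = u + a * (b + d * (j : ℚ)) ^ 2) ∧ x ≤ M}.Finite := by
  set R : ℚ := (|(M - u) / a| + 1 + |b|) / |d| with hR
  have hd' : 0 < |d| := abs_pos.mpr hd
  refine ((Set.finite_Icc (-⌈R⌉) ⌈R⌉).image
    (fun j : ℤ => u + a * (b + d * (j : ℚ)) ^ 2)).subset ?_
  rintro x ⟨⟨j, rfl⟩, hx⟩
  refine ⟨j, ?_, rfl⟩
  have h1 : (b + d * (j : ℚ)) ^ 2 ≤ |(M - u) / a| := by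
    refine le_trans ?_ (le_abs_self _)
    rw [le_div_iff₀ ha]
    linarith
  have h2 : |b + d * (j : ℚ)| ≤ |(M - u) / a| + 1 := by
    have := sq_abs (b + d * (j : ℚ))
    nlinarith [sq_nonneg (|b + d * (j : ℚ)| - 1), abs_nonneg ((M - u) / a)]
  have h3 : |d| * |(j : ℚ)| ≤ |(M - u) / a| + 1 + |b| := by
    rw [← abs_mul]
    have : |d * (j : ℚ)| ≤ |b + d * (j : ℚ)| + |b| := by
      have := abs_sub (b + d * (j : ℚ)) b
      simpa using this
    linarith
  have h4 : |(j : ℚ)| ≤ R := by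
    rw [hR, le_div_iff₀ hd']
    linarith
  have h5 : |(j : ℚ)| ≤ (⌈R⌉ : ℚ) := h4.trans (Int.le_ceil R)
  have h6 : |j| ≤ ⌈R⌉ := by exact_mod_cast h5
  exact abs_le.mp h6

theorem mr_quad_union {S T : Set ℚ} {M : ℚ} (hS : {x | x ∈ S ∧ x ≤ M}.Finite)
    (hT : {x | x ∈ T ∧ x ≤ M}.Finite) : {x | x ∈ S ∪ T ∧ x ≤ M}.Finite := by
  refine (hS.union hT).subset ?_
  rintro x ⟨h | h, hx⟩
  · exact Or.inl ⟨h, hx⟩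
  · exact Or.inr ⟨h, hx⟩

theorem mr_extra_finite (k : ℤ) (M : ℚ) : {x | x ∈ MRextra k ∧ x ≤ M}.Finite := by
  have q := fun u a b d (ha : (0 : ℚ) < a) hd => mr_quad_finite u a b d M ha hd
  unfold MRextra
  split_ifs
  · refine ((q (-49/8) (1/8) (10/3) 10 (by norm_num) (by norm_num)).union
      (q (-49/8) (1/8) 4 10 (by norm_num) (by norm_num))).subset ?_
    rintro x ⟨⟨j, h | h⟩, hx⟩
    · exact Or.inl ⟨⟨j, h⟩, hx⟩
    · exact Or.inr ⟨⟨j, h⟩, hx⟩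
  · exact q _ _ _ _ (by norm_num) (by norm_num)
  · refine ((q (-25/8) (1/8) 2 6 (by norm_num) (by norm_num)).union
      ((q (-25/8) (1/8) (3/2) 6 (by norm_num) (by norm_num)).union
      ((q (-25/8) (1/8) (6/5) 6 (by norm_num) (by norm_num)).union
      (q (-25/8) (1/8) (12/5) 6 (by norm_num) (by norm_num))))).subset ?_
    rintro x ⟨⟨j, h | h | h | h⟩, hx⟩
    · exact Or.inl ⟨⟨j, h⟩, hx⟩
    · exact Or.inr (Or.inl ⟨⟨j, h⟩, hx⟩)
    · exact Or.inr (Or.inr (Or.inl ⟨⟨j, h⟩, hx⟩))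
    · exact Or.inr (Or.inr (Or.inr ⟨⟨j, h⟩, hx⟩))
  · refine ((q (-1/8) (1/8) 2 6 (by norm_num) (by norm_num)).union
      ((q (-1/8) (1/8) (3/2) 6 (by norm_num) (by norm_num)).union
      ((q (-1/8) (1/8) (6/5) 6 (by norm_num) (by norm_num)).union
      (q (-1/8) (1/8) (12/5) 6 (by norm_num) (by norm_num))))).subset ?_
    rintro x ⟨⟨j, h | h | h | h⟩, hx⟩
    · exact Or.inl ⟨⟨j, h⟩, hx⟩
    · exact Or.inr (Or.inl ⟨⟨j, h⟩, hx⟩)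
    · exact Or.inr (Or.inr (Or.inl ⟨⟨j, h⟩, hx⟩))
    · exact Or.inr (Or.inr (Or.inr ⟨⟨j, h⟩, hx⟩))
  · exact q _ _ _ _ (by norm_num) (by norm_num)
  · refine ((q (-9/8) (1/8) (10/3) 10 (by norm_num) (by norm_num)).union
      (q (-9/8) (1/8) 4 10 (by norm_num) (by norm_num))).subset ?_
    rintro x ⟨⟨j, h | h⟩, hx⟩
    · exact Or.inl ⟨⟨j, h⟩, hx⟩
    · exact Or.inr ⟨⟨j, h⟩, hx⟩
  · simp

theorem mr_set_finite (k : ℤ) (hk : k ≠ 0) (M : ℚ) : {x | x ∈ MRset k ∧ x ≤ M}.Finite := by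
  have hk' : (k : ℚ) ≠ 0 := by exact_mod_cast hk
  refine mr_quad_union (mr_quad_union ?_ ?_) (mr_extra_finite k M)
  · refine (mr_quad_finite (-((k : ℚ) - 2) ^ 2 / 8) (1/2) (((k : ℚ) - 2) / 2) k M
      (by norm_num) hk').subset ?_
    rintro x ⟨⟨j, h⟩, hx⟩
    exact ⟨⟨j, by rw [h]; ring⟩, hx⟩
  · refine (mr_quad_finite (-(k : ℚ) ^ 2 / 8 + ((k : ℚ) - 1) / 2) (1/2) ((k : ℚ) / 2) k M
      (by norm_num) hk').subset ?_
    rintro x ⟨⟨j, h⟩, hx⟩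
    exact ⟨⟨j, by rw [h]; ring⟩, hx⟩

theorem mr_sum_finite (S : Set ℚ)
    (hS : ∀ e : ℚ, 0 < e → {x | x ∈ S ∧ ¬ (0 < x ∧ x < e)}.Finite) (p : ℕ) :
    ∀ c : ℚ, {x : Fin p → ℚ | (∀ i, x i ∈ S) ∧ ∑ i, x i = c}.Finite := by
  induction p with
  | zero => intro c; exact Set.toFinite _
  | succ p ih =>
    intro c
    obtain ⟨e, he, hec⟩ : ∃ e : ℚ, 0 < e ∧ (0 < c → e * (p + 1) = c) := by
      by_cases hc : 0 < c
      · exact ⟨c / (p + 1), by positivity, fun _ => by field_simp⟩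
      · exact ⟨1, one_pos, fun h => absurd h hc⟩
    refine (Set.finite_iUnion (fun i : Fin (p + 1) => (hS e he).biUnion
      (fun v _ => (ih (c - v)).image (fun y => (Fin.insertNth i v y : Fin (p + 1) → ℚ))))).subset ?_
    rintro x ⟨hx, hsum⟩
    have key : ∃ i, ¬ (0 < x i ∧ x i < e) := by
      by_contra! hcon
      have hpos : 0 < ∑ i, x i :=
        Finset.sum_pos (fun i _ => (hcon i).1) Finset.univ_nonempty
      have hlt : ∑ i, x i < ∑ _i : Fin (p + 1), e :=
        Finset.sum_lt_sum_of_nonempty Finset.univ_nonempty (fun i _ => (hcon i).2)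
      rw [hsum] at hpos hlt
      have := hec hpos
      simp at hlt
      linarith
    obtain ⟨i, hi⟩ := key
    simp only [Set.mem_iUnion]
    refine ⟨i, x i, ⟨hx i, hi⟩, i.removeNth x, ⟨fun j => hx _, ?_⟩, ?_⟩
    · rw [Fin.sum_univ_succAbove _ i] at hsum
      simp only [Fin.removeNth]
      linarith
    · simp

/-- For `k ∈ ℤ \ {−2,0,2}`, `p ≥ 1` and `c ∈ ℚ`, the set of nondecreasing tuples
`(λ₁ ≤ … ≤ λ_p)` of rationals with each `λᵢ ∈ E_k`, `λᵢ ≠ k`, and `∑ 1/(λᵢ − k) = c`,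
is finite. -/
theorem morales_ramis_diophantine_finite
    (k : ℤ) (hk : k ≠ -2 ∧ k ≠ 0 ∧ k ≠ 2) (p : ℕ) (hp : 1 ≤ p) (c : ℚ) :
    {lam : Fin p → ℚ | Monotone lam ∧
      (∀ i, lam i ∈ MRset k ∧ lam i ≠ (k : ℚ)) ∧
      ∑ i, (lam i - (k : ℚ))⁻¹ = c}.Finite := by
  have h := mr_sum_finite ((fun l : ℚ => (l - k)⁻¹) '' {l | l ∈ MRset k ∧ l ≠ (k : ℚ)})
    (by
      intro e he
      refine ((mr_set_finite k hk.2.1 (k + e⁻¹)).image (fun l : ℚ => (l - k)⁻¹)).subset ?_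
      rintro x ⟨⟨l, ⟨hl, hlk⟩, rfl⟩, hx⟩
      refine ⟨l, ⟨hl, ?_⟩, rfl⟩
      by_contra! hlt
      have he' : 0 < e⁻¹ := inv_pos.mpr he
      have h1 : e⁻¹ < l - k := by linarith
      exact hx ⟨inv_pos.mpr (he'.trans h1), inv_lt_of_inv_lt₀ he h1⟩) p c
  refine (h.image (fun x i => (x i)⁻¹ + (k : ℚ))).subset ?_
  rintro lam ⟨-, hl, hs⟩
  refine ⟨fun i => (lam i - k)⁻¹, ⟨fun i => ⟨lam i, hl i, rfl⟩, hs⟩, ?_⟩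
  funext i
  simp
end

section
/- Let I be a finite set of nonzero integers, let α be a nonzero integer, w₀ ∈ ℂ*, and for each i ∈ I let B_i ∈ ℂ[z] be a monic polynomial of positive degree which is squarefree, satisfies B_i(0) ≠ 0, and such that the B_i are pairwise coprime. Let G be the rational function G(z) = w₀·z^α·∏_{i∈I} B_i(z)^i, and let Z₁ ∈ ℂ[z] be the polynomial Z₁ = α·∏_{i∈I} B_i + z·∑_{j∈I} j·B_j′·∏_{i∈I, i≠j} B_i. Then the set of complex roots of Z₁ equals the set of Darboux points of G, i.e. the set of ζ ∈ ℂ with ζ ≠ 0, ∏_{i∈I} B_i(ζ) ≠ 0 (so G is defined and nonzero at ζ) and G′(ζ) = 0. Moreover, if ζ is a Darboux point of G with G″(ζ) ≠ 0 (a simple Darboux point), then ζ is a simple root of Z₁, i.e. Z₁′(ζ) ≠ 0. -/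
/-- The model function `G(z) = w₀ · z^α · ∏_{i ∈ Idx} B_i(z)^i`. -/
noncomputable def Gfun (w₀ : ℂ) (α : ℤ) (Idx : Finset ℤ) (B : ℤ → Polynomial ℂ)
    (z : ℂ) : ℂ :=
  w₀ * z ^ α * ∏ i ∈ Idx, (B i).eval z ^ i

/-- The polynomial `Z₁ = α·∏ B_i + z·∑_j j·B_j′·∏_{i≠j} B_i`
(the numerator of the logarithmic derivative `G′/G`). -/
noncomputable def Z1 (α : ℤ) (Idx : Finset ℤ) (B : ℤ → Polynomial ℂ) : Polynomial ℂ :=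
  Polynomial.C (α : ℂ) * ∏ i ∈ Idx, B i +
    Polynomial.X * ∑ j ∈ Idx, Polynomial.C (j : ℂ) * Polynomial.derivative (B j) *
      ∏ i ∈ Idx.erase j, B i

open Polynomial in
theorem Z1_eval (α : ℤ) (Idx : Finset ℤ) (B : ℤ → Polynomial ℂ) (z : ℂ) :
    (Z1 α Idx B).eval z = α * ∏ i ∈ Idx, (B i).eval z +
      z * ∑ j ∈ Idx, (j : ℂ) * (derivative (B j)).eval z * ∏ i ∈ Idx.erase j, (B i).eval z := by
  simp only [Z1, eval_add, eval_mul, eval_C, eval_X, eval_prod, eval_finset_sum]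

theorem Gfun_hasDerivAt (w₀ : ℂ) (α : ℤ) (Idx : Finset ℤ) (B : ℤ → Polynomial ℂ) (z : ℂ)
    (hz : z ≠ 0) (hP : (∏ i ∈ Idx, (B i).eval z) ≠ 0) :
    HasDerivAt (Gfun w₀ α Idx B)
      (Gfun w₀ α Idx B z / (z * ∏ i ∈ Idx, (B i).eval z) * (Z1 α Idx B).eval z) z := by
  have hB : ∀ i ∈ Idx, (B i).eval z ≠ 0 := Finset.prod_ne_zero_iff.mp hP
  have h1 : ∀ i ∈ Idx, HasDerivAt (fun x => (B i).eval x ^ i)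
      ((i : ℂ) * (B i).eval z ^ (i - 1) * (Polynomial.derivative (B i)).eval z) z := by
    intro i hi
    exact (hasDerivAt_zpow i _ (Or.inl (hB i hi))).comp z ((B i).hasDerivAt z)
  have h2 := HasDerivAt.fun_finset_prod h1
  have h3 := ((hasDerivAt_zpow α z (Or.inl hz)).const_mul w₀).mul h2
  have h4 : ∑ i ∈ Idx, (∏ j ∈ Idx.erase i, (B j).eval z ^ j) •
      ((i : ℂ) * (B i).eval z ^ (i - 1) * (Polynomial.derivative (B i)).eval z)
      = (∏ i ∈ Idx, (B i).eval z ^ i) / (∏ i ∈ Idx, (B i).eval z) *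
        ∑ j ∈ Idx, (j : ℂ) * (Polynomial.derivative (B j)).eval z *
          ∏ i ∈ Idx.erase j, (B i).eval z := by
    rw [Finset.mul_sum]
    refine Finset.sum_congr rfl fun i hi => ?_
    have hQ : (∏ j ∈ Idx.erase i, (B j).eval z) ≠ 0 :=
      Finset.prod_ne_zero_iff.mpr fun j hj => hB j (Finset.mem_of_mem_erase hj)
    have hb := hB i hi
    rw [← Finset.mul_prod_erase Idx (fun i => (B i).eval z ^ i) hi,
      ← Finset.mul_prod_erase Idx (fun i => (B i).eval z) hi, zpow_sub_one₀ hb, smul_eq_mul]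
    field_simp
  rw [h4] at h3
  refine h3.congr_deriv ?_
  rw [Z1_eval, zpow_sub_one₀ hz, Gfun]
  field_simp

theorem Z1_root_ne (α : ℤ) (hα : α ≠ 0)
    (Idx : Finset ℤ) (hIdx : ∀ i ∈ Idx, i ≠ 0)
    (B : ℤ → Polynomial ℂ)
    (hsf : ∀ i ∈ Idx, Squarefree (B i))
    (h0 : ∀ i ∈ Idx, (B i).eval 0 ≠ 0)
    (hcop : ∀ i ∈ Idx, ∀ j ∈ Idx, i ≠ j → IsCoprime (B i) (B j))
    (z : ℂ) (h : (Z1 α Idx B).eval z = 0) : z ≠ 0 ∧ (∏ i ∈ Idx, (B i).eval z) ≠ 0 := by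
  rw [Z1_eval] at h
  have hz : z ≠ 0 := by
    rintro rfl
    rw [zero_mul, add_zero] at h
    exact mul_ne_zero (by exact_mod_cast hα) (Finset.prod_ne_zero_iff.mpr h0) h
  refine ⟨hz, fun hP => ?_⟩
  obtain ⟨k, hk, hk0⟩ := Finset.prod_eq_zero_iff.mp hP
  rw [hP, mul_zero, zero_add, Finset.sum_eq_single_of_mem k hk] at h
  · have hd : (Polynomial.derivative (B k)).eval z ≠ 0 := by
      intro hd
      obtain ⟨a, b, hab⟩ := PerfectField.separable_iff_squarefree.mpr (hsf k hk)
      have := congrArg (Polynomial.eval z) hab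
      simp [hk0, hd] at this
    refine mul_ne_zero hz (mul_ne_zero (mul_ne_zero (by exact_mod_cast hIdx k hk) hd) ?_) h
    refine Finset.prod_ne_zero_iff.mpr fun j hj hj0 => ?_
    obtain ⟨hjk, hj⟩ := Finset.mem_erase.mp hj
    obtain ⟨a, b, hab⟩ := hcop j hj k hk hjk
    have := congrArg (Polynomial.eval z) hab
    simp [hk0, hj0] at this
  · intro j hj hjk
    rw [Finset.prod_eq_zero (Finset.mem_erase.mpr ⟨hjk.symm, hk⟩) hk0, mul_zero]

/-- For a model function `G = w₀ z^α ∏ B_i^i` (with `α ≠ 0`, `w₀ ≠ 0`, the indices nonzero,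
the `B_i` monic, squarefree, of positive degree, nonvanishing at `0`, pairwise coprime),
the roots of `Z₁` are exactly the Darboux points of `G` (points `ζ ≠ 0` with
`∏ B_i(ζ) ≠ 0`, so `G` defined and nonzero at `ζ`, and `G′(ζ) = 0`); and every simple
Darboux point (`G″(ζ) ≠ 0`) is a simple root of `Z₁`. -/
theorem Z1_roots_are_darboux_points
    (w₀ : ℂ) (hw₀ : w₀ ≠ 0) (α : ℤ) (hα : α ≠ 0)
    (Idx : Finset ℤ) (hIdx : ∀ i ∈ Idx, i ≠ 0)
    (B : ℤ → Polynomial ℂ)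
    (hmonic : ∀ i ∈ Idx, (B i).Monic)
    (hdeg : ∀ i ∈ Idx, 0 < (B i).natDegree)
    (hsf : ∀ i ∈ Idx, Squarefree (B i))
    (h0 : ∀ i ∈ Idx, (B i).eval 0 ≠ 0)
    (hcop : ∀ i ∈ Idx, ∀ j ∈ Idx, i ≠ j → IsCoprime (B i) (B j)) :
    (∀ ζ : ℂ, (Z1 α Idx B).eval ζ = 0 ↔
      (ζ ≠ 0 ∧ (∏ i ∈ Idx, (B i).eval ζ) ≠ 0 ∧ deriv (Gfun w₀ α Idx B) ζ = 0)) ∧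
    (∀ ζ : ℂ, ζ ≠ 0 → (∏ i ∈ Idx, (B i).eval ζ) ≠ 0 →
      deriv (Gfun w₀ α Idx B) ζ = 0 → deriv (deriv (Gfun w₀ α Idx B)) ζ ≠ 0 →
      (Polynomial.derivative (Z1 α Idx B)).eval ζ ≠ 0) := by
  have hG : ∀ z : ℂ, z ≠ 0 → (∏ i ∈ Idx, (B i).eval z) ≠ 0 →
      Gfun w₀ α Idx B z / (z * ∏ i ∈ Idx, (B i).eval z) ≠ 0 := by
    intro z hz hP
    refine div_ne_zero (mul_ne_zero (mul_ne_zero hw₀ (zpow_ne_zero _ hz)) ?_) (mul_ne_zero hz hP)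
    exact Finset.prod_ne_zero_iff.mpr fun i hi =>
      zpow_ne_zero _ (Finset.prod_ne_zero_iff.mp hP i hi)
  have key : ∀ z : ℂ, z ≠ 0 → (∏ i ∈ Idx, (B i).eval z) ≠ 0 →
      deriv (Gfun w₀ α Idx B) z = 0 → (Z1 α Idx B).eval z = 0 := by
    intro z hz hP hd
    rw [(Gfun_hasDerivAt w₀ α Idx B z hz hP).deriv] at hd
    exact (mul_eq_zero.mp hd).resolve_left (hG z hz hP)
  refine ⟨fun z => ⟨fun h => ?_, fun h => key z h.1 h.2.1 h.2.2⟩, ?_⟩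
  · obtain ⟨hz, hP⟩ := Z1_root_ne α hα Idx hIdx B hsf h0 hcop z h
    refine ⟨hz, hP, ?_⟩
    rw [(Gfun_hasDerivAt w₀ α Idx B z hz hP).deriv, h, mul_zero]
  · intro z hz hP hd hdd hZ
    apply hdd
    have hZ0 := key z hz hP hd
    have hcP : Continuous fun x : ℂ => ∏ i ∈ Idx, (B i).eval x :=
      continuous_finsetProd _ fun i _ => (B i).continuous
    have hev : deriv (Gfun w₀ α Idx B) =ᶠ[nhds z] fun x =>
        Gfun w₀ α Idx B x / (x * ∏ i ∈ Idx, (B i).eval x) * (Z1 α Idx B).eval x := by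
      filter_upwards [isOpen_ne.mem_nhds hz, hcP.continuousAt.eventually_ne hP] with x hx hx'
      exact (Gfun_hasDerivAt w₀ α Idx B x hx hx').deriv
    rw [hev.deriv_eq]
    have hdP : DifferentiableAt ℂ (fun x : ℂ => ∏ i ∈ Idx, (B i).eval x) z :=
      (HasDerivAt.fun_finset_prod fun i _ => (B i).hasDerivAt z).differentiableAt
    have hH : DifferentiableAt ℂ (fun x =>
        Gfun w₀ α Idx B x / (x * ∏ i ∈ Idx, (B i).eval x)) z :=
      (Gfun_hasDerivAt w₀ α Idx B z hz hP).differentiableAt.fun_div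
        (differentiableAt_id.fun_mul hdP) (mul_ne_zero hz hP)
    have := (hH.hasDerivAt.fun_mul ((Z1 α Idx B).hasDerivAt z)).deriv
    rw [this, hZ, hZ0, mul_zero, mul_zero, add_zero]
end

section
/- Let I be a finite set of nonzero integers, α a nonzero integer, w₀ ∈ ℂ*, and for each i ∈ I let B_i ∈ ℂ[z] be a monic squarefree polynomial of positive degree β_i with B_i(0) ≠ 0, the B_i being pairwise coprime; assume moreover α + ∑_{i∈I} i·β_i ≠ 0. Let G(z) = w₀·z^α·∏_{i∈I} B_i(z)^i, let k be an integer with k ∉ {−2,0,2}, and let Z₁ = α·∏_{i∈I} B_i + z·∑_{j∈I} j·B_j′·∏_{i≠j} B_i ∈ ℂ[z]. Let S be a finite set of rational numbers with k ∉ S, and let Z_{2,S} ∈ ℂ[z] be the product over λ ∈ S of the numerators (in lowest terms) of the rational functions k − z²·G″(z)/G(z) − λ. Then Z₁ divides Z_{2,S} in ℂ[z] if and only if all Darboux points of G are simple and every associated eigenvalue k − ζ²G″(ζ)/G(ζ), for ζ a Darboux point of G, belongs to S. -/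
open Polynomial

lemma aux_diff (w₀ : ℂ) (α : ℤ) (Idx : Finset ℤ) (B : ℤ → Polynomial ℂ) (z : ℂ) (hz : z ≠ 0)
    (hP : (∏ i ∈ Idx, (B i).eval z) ≠ 0) : DifferentiableAt ℂ (Gfun w₀ α Idx B) z := by
  rw [Finset.prod_ne_zero_iff] at hP
  unfold Gfun
  apply DifferentiableAt.mul
  · exact (differentiableAt_const _).mul (differentiableAt_id.zpow (Or.inl hz))
  · apply DifferentiableAt.fun_finsetProd
    intro i hi
    exact ((B i).differentiableAt).zpow (Or.inl (hP i hi))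

lemma aux_ne (w₀ : ℂ) (hw₀ : w₀ ≠ 0) (α : ℤ) (Idx : Finset ℤ) (B : ℤ → Polynomial ℂ) (z : ℂ)
    (hz : z ≠ 0) (hP : (∏ i ∈ Idx, (B i).eval z) ≠ 0) : Gfun w₀ α Idx B z ≠ 0 := by
  rw [Finset.prod_ne_zero_iff] at hP
  unfold Gfun
  exact mul_ne_zero (mul_ne_zero hw₀ (zpow_ne_zero _ hz))
    (Finset.prod_ne_zero_iff.2 fun i hi => zpow_ne_zero _ (hP i hi))

lemma aux_log (w₀ : ℂ) (hw₀ : w₀ ≠ 0) (α : ℤ) (Idx : Finset ℤ) (B : ℤ → Polynomial ℂ) (z : ℂ)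
    (hz : z ≠ 0) (hP : (∏ i ∈ Idx, (B i).eval z) ≠ 0) :
    logDeriv (Gfun w₀ α Idx B) z = α / z + ∑ i ∈ Idx, i * ((derivative (B i)).eval z / (B i).eval z) := by
  have hP' := hP
  rw [Finset.prod_ne_zero_iff] at hP
  have hd : ∀ i ∈ Idx, DifferentiableAt ℂ (fun z => (B i).eval z ^ i) z := fun i hi =>
    ((B i).differentiableAt).zpow (Or.inl (hP i hi))
  have e : Gfun w₀ α Idx B = fun z => (w₀ * z ^ α) * ∏ i ∈ Idx, (B i).eval z ^ i := rfl
  rw [e, logDeriv_mul]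
  · congr 1
    · rw [logDeriv_const_mul _ _ hw₀, logDeriv_zpow]
    · rw [logDeriv_prod (s := Idx) (f := fun i z => (B i).eval z ^ i)]
      · apply Finset.sum_congr rfl
        intro i hi
        rw [logDeriv_fun_zpow (B i).differentiableAt, logDeriv_apply, Polynomial.deriv]
      · exact fun i hi => zpow_ne_zero _ (hP i hi)
      · exact hd
  · exact mul_ne_zero hw₀ (zpow_ne_zero _ hz)
  · exact (Finset.prod_ne_zero_iff.2 fun i hi => zpow_ne_zero _ (hP i hi))
  · exact (differentiableAt_const _).mul (differentiableAt_id.zpow (Or.inl hz))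
  · exact DifferentiableAt.fun_finsetProd hd

lemma aux_Z1 (α : ℤ) (Idx : Finset ℤ) (B : ℤ → Polynomial ℂ) (z : ℂ)
    (hz : z ≠ 0) (hP : (∏ i ∈ Idx, (B i).eval z) ≠ 0) :
    (Z1 α Idx B).eval z = z * (∏ i ∈ Idx, (B i).eval z) *
      (α / z + ∑ i ∈ Idx, i * ((derivative (B i)).eval z / (B i).eval z)) := by
  have hP' := hP
  rw [Finset.prod_ne_zero_iff] at hP
  simp only [Z1, eval_add, eval_mul, eval_C, eval_X, eval_prod, eval_finsetSum]
  rw [mul_add]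
  congr 1
  · field_simp
  · rw [mul_assoc, Finset.mul_sum (a := ∏ i ∈ Idx, (B i).eval z)]
    congr 1
    apply Finset.sum_congr rfl
    intro i hi
    rw [← Finset.mul_prod_erase Idx _ hi]
    have := hP i hi
    field_simp

lemma aux_deriv (w₀ : ℂ) (hw₀ : w₀ ≠ 0) (α : ℤ) (Idx : Finset ℤ) (B : ℤ → Polynomial ℂ) (z : ℂ)
    (hz : z ≠ 0) (hP : (∏ i ∈ Idx, (B i).eval z) ≠ 0) :
    deriv (Gfun w₀ α Idx B) z =
      Gfun w₀ α Idx B z * ((Z1 α Idx B).eval z / (z * (∏ i ∈ Idx, B i).eval z)) := by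
  have h := aux_log w₀ hw₀ α Idx B z hz hP
  have hG := aux_ne w₀ hw₀ α Idx B z hz hP
  rw [aux_Z1 α Idx B z hz hP, ← h, logDeriv_apply, eval_prod]
  field_simp

lemma aux_deriv2 (w₀ : ℂ) (hw₀ : w₀ ≠ 0) (α : ℤ) (Idx : Finset ℤ) (B : ℤ → Polynomial ℂ) (z : ℂ)
    (hz : z ≠ 0) (hP : (∏ i ∈ Idx, (B i).eval z) ≠ 0) :
    z ^ 2 * deriv (deriv (Gfun w₀ α Idx B)) z / Gfun w₀ α Idx B z =
      (X * (derivative (Z1 α Idx B) * (∏ i ∈ Idx, B i) - Z1 α Idx B * derivative (∏ i ∈ Idx, B i))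
        + Z1 α Idx B ^ 2 - Z1 α Idx B * (∏ i ∈ Idx, B i)).eval z
      / (∏ i ∈ Idx, B i).eval z ^ 2 := by
  have hG := aux_ne w₀ hw₀ α Idx B z hz hP
  have hev : deriv (Gfun w₀ α Idx B) =ᶠ[nhds z] fun z =>
      Gfun w₀ α Idx B z * ((Z1 α Idx B).eval z / (z * (∏ i ∈ Idx, B i).eval z)) := by
    have h1 : ∀ᶠ y in nhds z, y ≠ 0 := continuousAt_id.eventually_ne hz
    have h2 : ∀ᶠ y in nhds z, (∏ i ∈ Idx, B i).eval y ≠ 0 :=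
      (∏ i ∈ Idx, B i).continuousAt.eventually_ne (by rwa [eval_prod])
    filter_upwards [h1, h2] with y hy1 hy2
    rw [eval_prod] at hy2
    exact aux_deriv w₀ hw₀ α Idx B y hy1 hy2
  rw [hev.deriv_eq]
  have hD := (aux_diff w₀ α Idx B z hz hP).hasDerivAt
  rw [aux_deriv w₀ hw₀ α Idx B z hz hP] at hD
  have hP2 : (∏ i ∈ Idx, B i).eval z ≠ 0 := by rwa [eval_prod]
  generalize (∏ i ∈ Idx, B i) = P at *
  have h3 := hD.mul (((Z1 α Idx B).hasDerivAt z).div ((hasDerivAt_id z).mul (P.hasDerivAt z))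
    (mul_ne_zero hz hP2))
  have h4 := h3.deriv
  simp only [Pi.mul_def, Pi.div_def, id] at h4
  rw [h4]
  simp only [eval_add, eval_mul, eval_sub, eval_X, eval_pow]
  field_simp
  ring

lemma aux_coprime (α : ℤ) (hα : α ≠ 0) (Idx : Finset ℤ) (hIdx : ∀ i ∈ Idx, i ≠ 0)
    (B : ℤ → Polynomial ℂ)
    (hsf : ∀ i ∈ Idx, Squarefree (B i))
    (h0 : ∀ i ∈ Idx, (B i).eval 0 ≠ 0)
    (hcop : ∀ i ∈ Idx, ∀ j ∈ Idx, i ≠ j → IsCoprime (B i) (B j)) (z : ℂ)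
    (hz : (Z1 α Idx B).eval z = 0) : z ≠ 0 ∧ (∏ i ∈ Idx, (B i).eval z) ≠ 0 := by
  simp only [Z1, eval_add, eval_mul, eval_C, eval_X, eval_prod, eval_finsetSum] at hz
  have hz0 : z ≠ 0 := by
    rintro rfl
    rw [zero_mul, add_zero] at hz
    exact mul_ne_zero (Int.cast_ne_zero.2 hα) (Finset.prod_ne_zero_iff.2 h0) hz
  refine ⟨hz0, fun hP => ?_⟩
  rw [hP, mul_zero, zero_add] at hz
  obtain ⟨j, hj, hjz⟩ := Finset.prod_eq_zero_iff.1 hP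
  rw [Finset.sum_eq_single_of_mem j hj] at hz
  · have hd : (derivative (B j)).eval z ≠ 0 := by
      have hs : (B j).Separable := PerfectField.separable_iff_squarefree.2 (hsf j hj)
      obtain ⟨a, b, hab⟩ := hs
      intro h
      have := congrArg (eval z) hab
      simp [h, hjz] at this
    have hp : ∏ i ∈ Idx.erase j, (B i).eval z ≠ 0 := by
      refine Finset.prod_ne_zero_iff.2 fun i hi h => ?_
      obtain ⟨hij, hi⟩ := Finset.mem_erase.1 hi
      obtain ⟨a, b, hab⟩ := hcop i hi j hj hij
      have := congrArg (eval z) hab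
      simp [h, hjz] at this
    exact mul_ne_zero hz0 (mul_ne_zero (mul_ne_zero (Int.cast_ne_zero.2 (hIdx j hj)) hd) hp) hz
  · intro i hi hij
    rw [Finset.prod_eq_zero (Finset.mem_erase.2 ⟨hij.symm, hj⟩) hjz, mul_zero]

/-- For a model function `G = w₀ z^α ∏ B_i^i` with `α ≠ 0` and
`α + ∑ i·deg B_i ≠ 0`, an integer `k ∉ {−2,0,2}` and a finite set `S ⊆ ℚ` with `k ∉ S`,
let `Z_{2,S} = ∏_{μ ∈ S} N μ` where `N μ / D μ` is the lowest-terms representation of the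
rational function `k − z²G″(z)/G(z) − μ`. Then `Z₁ ∣ Z_{2,S}` iff all Darboux points of
`G` are simple and all associated eigenvalues `k − ζ²G″(ζ)/G(ζ)` belong to `S`. -/
theorem Z1_divides_Z2_iff
    (w₀ : ℂ) (hw₀ : w₀ ≠ 0) (α : ℤ) (hα : α ≠ 0)
    (Idx : Finset ℤ) (hIdx : ∀ i ∈ Idx, i ≠ 0)
    (B : ℤ → Polynomial ℂ)
    (hmonic : ∀ i ∈ Idx, (B i).Monic)
    (hdeg : ∀ i ∈ Idx, 0 < (B i).natDegree)
    (hsf : ∀ i ∈ Idx, Squarefree (B i))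
    (h0 : ∀ i ∈ Idx, (B i).eval 0 ≠ 0)
    (hcop : ∀ i ∈ Idx, ∀ j ∈ Idx, i ≠ j → IsCoprime (B i) (B j))
    (hsum : α + ∑ i ∈ Idx, i * ((B i).natDegree : ℤ) ≠ 0)
    (k : ℤ) (hk : k ≠ -2 ∧ k ≠ 0 ∧ k ≠ 2)
    (S : Finset ℚ) (hkS : (k : ℚ) ∉ S)
    (N D : ℚ → Polynomial ℂ)
    (hlowest : ∀ μ ∈ S, IsCoprime (N μ) (D μ) ∧ (D μ).Monic ∧
      ∀ z : ℂ, z ≠ 0 → (∏ i ∈ Idx, (B i).eval z) ≠ 0 → (D μ).eval z ≠ 0 →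
        (N μ).eval z / (D μ).eval z
          = (k : ℂ) - z ^ 2 * deriv (deriv (Gfun w₀ α Idx B)) z / Gfun w₀ α Idx B z
              - (μ : ℂ)) :
    Z1 α Idx B ∣ ∏ μ ∈ S, N μ ↔
      (∀ ζ : ℂ, ζ ≠ 0 → (∏ i ∈ Idx, (B i).eval ζ) ≠ 0 →
        deriv (Gfun w₀ α Idx B) ζ = 0 →
          (deriv (deriv (Gfun w₀ α Idx B)) ζ ≠ 0 ∧
           ∃ μ ∈ S, (k : ℂ) - ζ ^ 2 * deriv (deriv (Gfun w₀ α Idx B)) ζ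
              / Gfun w₀ α Idx B ζ = (μ : ℂ))) := by
  set P := ∏ i ∈ Idx, B i with hPdef
  have hPe : ∀ z, P.eval z = ∏ i ∈ Idx, (B i).eval z := fun z => eval_prod _ _ _
  have hZ0 : Z1 α Idx B ≠ 0 := by
    intro h
    exact (aux_coprime α hα Idx hIdx B hsf h0 hcop 0 (by rw [h, eval_zero])).1 rfl
  have hP0 : P ≠ 0 := Finset.prod_ne_zero_iff.2 fun i hi => (hmonic i hi).ne_zero
  constructor
  · intro hdvd ζ hζ hPζ hG'
    have hG := aux_ne w₀ hw₀ α Idx B ζ hζ hPζ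
    have hZ : (Z1 α Idx B).eval ζ = 0 := by
      rw [aux_deriv w₀ hw₀ α Idx B ζ hζ hPζ] at hG'
      have h2 : ζ * (∏ i ∈ Idx, B i).eval ζ ≠ 0 := mul_ne_zero hζ (by rwa [eval_prod])
      simpa [hG, h2, div_eq_zero_iff, -mul_eq_zero] using (mul_eq_zero.1 hG').resolve_left hG
    have hprod := eval_eq_zero_of_dvd_of_eval_eq_zero hdvd hZ
    rw [eval_prod] at hprod
    obtain ⟨μ, hμ, hN⟩ := Finset.prod_eq_zero_iff.1 hprod
    obtain ⟨⟨a, b, hab⟩, -, hND⟩ := hlowest μ hμ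
    have hD : (D μ).eval ζ ≠ 0 := by
      intro h
      have := congrArg (eval ζ) hab
      simp [h, hN] at this
    have h := hND ζ hζ hPζ hD
    rw [hN, zero_div] at h
    have hval := (sub_eq_zero.1 h.symm)
    refine ⟨fun h2 => ?_, μ, hμ, hval⟩
    rw [h2, mul_zero, zero_div, sub_zero] at hval
    have : (k : ℚ) = μ := by exact_mod_cast hval
    exact hkS (this ▸ hμ)
  · intro hall
    have key : ∀ ζ, (Z1 α Idx B).eval ζ = 0 →
        (derivative (Z1 α Idx B)).eval ζ ≠ 0 ∧ (∏ μ ∈ S, N μ).eval ζ = 0 := by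
      intro ζ hZ
      obtain ⟨hζ, hPζ⟩ := aux_coprime α hα Idx hIdx B hsf h0 hcop ζ hZ
      have hG := aux_ne w₀ hw₀ α Idx B ζ hζ hPζ
      have hG' : deriv (Gfun w₀ α Idx B) ζ = 0 := by
        rw [aux_deriv w₀ hw₀ α Idx B ζ hζ hPζ, hZ, zero_div, mul_zero]
      obtain ⟨hs, μ, hμ, hval⟩ := hall ζ hζ hPζ hG'
      have h2 := aux_deriv2 w₀ hw₀ α Idx B ζ hζ hPζ
      constructor
      · intro hd
        have h3 : ζ ^ 2 * deriv (deriv (Gfun w₀ α Idx B)) ζ / Gfun w₀ α Idx B ζ ≠ 0 :=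
          div_ne_zero (mul_ne_zero (pow_ne_zero _ hζ) hs) hG
        rw [h2] at h3
        apply h3
        simp [hd, hZ]
      · rw [eval_prod]
        refine Finset.prod_eq_zero hμ ?_
        obtain ⟨-, hmon, hND⟩ := hlowest μ hμ
        rw [h2] at hval
        rw [← hPdef] at hval
        set Q := X * (derivative (Z1 α Idx B) * P - Z1 α Idx B * derivative P)
          + Z1 α Idx B ^ 2 - Z1 α Idx B * P with hQ
        have hid : N μ * P ^ 2 = D μ * (C ((k : ℂ) - μ) * P ^ 2 - Q) := by
          have hne : X * P * D μ ≠ 0 := mul_ne_zero (mul_ne_zero X_ne_zero hP0) hmon.ne_zero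
          apply mul_right_cancel₀ hne
          apply Polynomial.funext
          intro z
          by_cases hz : (X * P * D μ).eval z = 0
          · rw [eval_mul, hz, mul_zero, eval_mul, hz, mul_zero]
          · have hz' := hz
            rw [eval_mul, eval_mul, eval_X] at hz'
            have hDz := right_ne_zero_of_mul hz'
            have hzz := left_ne_zero_of_mul (left_ne_zero_of_mul hz')
            have hPz := right_ne_zero_of_mul (left_ne_zero_of_mul hz')
            have h5 := hND z hzz (by rwa [← hPe]) hDz
            rw [aux_deriv2 w₀ hw₀ α Idx B z hzz (by rwa [← hPe]), ← hPdef, ← hQ] at h5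
            rw [eval_mul, eval_mul (p := D μ * _)]
            congr 1
            simp only [eval_mul, eval_sub, eval_C, eval_pow]
            field_simp at h5
            linear_combination h5
        have h6 := congrArg (eval ζ) hid
        simp only [eval_mul, eval_sub, eval_C, eval_pow] at h6
        have hPz : P.eval ζ ≠ 0 := by rwa [hPe]
        have h7 : ((k : ℂ) - μ) * P.eval ζ ^ 2 - Q.eval ζ = 0 := by
          field_simp at hval
          linear_combination hval
        rw [h7, mul_zero] at h6
        exact (mul_eq_zero.1 h6).resolve_right (pow_ne_zero _ hPz)
    by_cases hN0 : ∏ μ ∈ S, N μ = 0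
    · rw [hN0]; exact dvd_zero _
    apply (IsAlgClosed.splits (Z1 α Idx B)).dvd_of_roots_le_roots hZ0
    have hnd : (Z1 α Idx B).roots.Nodup := by
      rw [Multiset.nodup_iff_count_le_one]
      intro a
      rw [count_roots]
      by_contra! h
      obtain ⟨h1, h2⟩ := (one_lt_rootMultiplicity_iff_isRoot hZ0).1 h
      exact (key a h1).1 h2
    rw [Multiset.le_iff_subset hnd]
    intro a ha
    rw [mem_roots hZ0] at ha
    rw [mem_roots hN0]
    exact (key a ha).2
end
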